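/- arXiv:1009.4297 — 2 statements merged into one kernel-verified Lean document; each statement's English description precedes it below -/
import Mathlib

section
/- If J₁ > 0 and J₂ > 0, then for every even positive integer N the minimum of H_N over all spin configurations on T_N equals −max{J₁, J₂} · N². -/
open scoped BigOperators

/-- The `N × N` torus `(ℤ/Nℤ)²`. -/
abbrev Torus (N : ℕ) := ZMod N × ZMod N

/-- A spin configuration assigns a unit vector of `ℝ²` to each site. -/
def IsConfig {N : ℕ} (S : Torus N → ℝ × ℝ) : Prop :=
  ∀ r, (S r).1 ^ 2 + (S r).2 ^ 2 = 1

/-- The plaquette-orbital Hamiltonian on the torus. -/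
noncomputable def ham (N : ℕ) [NeZero N] (J₁ J₂ : ℝ) (S : Torus N → ℝ × ℝ) : ℝ :=
  - J₁ * ((∑ r : Torus N, if Even r.1.val then (S r).1 * (S (r + (1, 0))).1 else 0)
        + (∑ r : Torus N, if Even r.2.val then (S r).1 * (S (r + (0, 1))).1 else 0))
  - J₂ * ((∑ r : Torus N, if ¬ Even r.1.val then (S r).2 * (S (r + (1, 0))).2 else 0)
        + (∑ r : Torus N, if ¬ Even r.2.val then (S r).2 * (S (r + (0, 1))).2 else 0))

/-- Parity of representatives alternates along `ℤ/Nℤ` when `N` is even. -/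
lemma ZMod.even_val_add_one {N : ℕ} [NeZero N] (hN : Even N) (a : ZMod N) :
    Even (a + 1).val ↔ ¬ Even a.val := by
  have h2 : 2 ∣ N := hN.two_dvd
  rw [ZMod.val_add, ZMod.val_one_eq_one_mod, Nat.add_mod_mod, Nat.even_iff, Nat.even_iff,
    Nat.mod_mod_of_dvd _ h2]
  omega

/-- If translation by `d` swaps `P` and its complement, the pairs `{r, r + d}` with `P r`
cover every point exactly once. -/
lemma sum_ite_add_translate {G : Type*} [AddGroup G] [Fintype G] (d : G) (P : G → Prop)
    [DecidablePred P] (hP : ∀ r, P (r + d) ↔ ¬ P r) (f : G → ℝ) :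
    (∑ r, if P r then f r + f (r + d) else 0) = ∑ r, f r := by
  have h : (∑ r, if P r then f (r + d) else 0) = ∑ r, if P r then 0 else f r := by
    rw [← Equiv.sum_comp (Equiv.addRight d) (fun r => if P r then 0 else f r)]
    refine Finset.sum_congr rfl fun r _ => ?_
    by_cases hr : P r <;> simp [hP, hr]
  calc (∑ r, if P r then f r + f (r + d) else 0)
      = (∑ r, if P r then f r else 0) + ∑ r, if P r then f (r + d) else 0 := by
        rw [← Finset.sum_add_distrib]
        refine Finset.sum_congr rfl fun r _ => ?_
        split_ifs <;> simp
    _ = ∑ r, f r := by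
        rw [h, ← Finset.sum_add_distrib]
        refine Finset.sum_congr rfl fun r _ => ?_
        split_ifs <;> simp

lemma two_mul_sum_ite_mul_translate_le {G : Type*} [AddGroup G] [Fintype G] (d : G)
    (P : G → Prop) [DecidablePred P] (hP : ∀ r, P (r + d) ↔ ¬ P r) (f : G → ℝ) :
    2 * (∑ r, if P r then f r * f (r + d) else 0) ≤ ∑ r, f r ^ 2 := by
  rw [← sum_ite_add_translate d P hP (fun r => f r ^ 2), Finset.mul_sum]
  refine Finset.sum_le_sum fun r _ => ?_
  split_ifs
  · nlinarith [sq_nonneg (f r - f (r + d))]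
  · simp

lemma two_mul_sum_ite_one {G : Type*} [AddGroup G] [Fintype G] (d : G)
    (P : G → Prop) [DecidablePred P] (hP : ∀ r, P (r + d) ↔ ¬ P r) :
    2 * (∑ r, if P r then (1 : ℝ) else 0) = Fintype.card G := by
  have h := sum_ite_add_translate d P hP (fun _ => 1)
  rw [Finset.sum_const, Finset.card_univ, nsmul_eq_mul, mul_one] at h
  rw [← h, Finset.mul_sum]
  refine Finset.sum_congr rfl fun r _ => ?_
  split_ifs <;> norm_num

/-- The minimum of `H_N` over all unit-spin configurations equals `−max{J₁,J₂}·N²`. -/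
theorem min_ham (N : ℕ) [NeZero N] (hN : Even N) (J₁ J₂ : ℝ) (hJ₁ : 0 < J₁) (hJ₂ : 0 < J₂) :
    IsLeast {E : ℝ | ∃ S : Torus N → ℝ × ℝ, IsConfig S ∧ ham N J₁ J₂ S = E}
      (-(max J₁ J₂) * (N : ℝ) ^ 2) := by
  have hfst (r : Torus N) : Even (r + (1, 0)).1.val ↔ ¬ Even r.1.val :=
    ZMod.even_val_add_one hN r.1
  have hsnd (r : Torus N) : Even (r + (0, 1)).2.val ↔ ¬ Even r.2.val :=
    ZMod.even_val_add_one hN r.2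
  have hfst' (r : Torus N) : ¬ Even (r + (1, 0)).1.val ↔ ¬ ¬ Even r.1.val := not_congr (hfst r)
  have hsnd' (r : Torus N) : ¬ Even (r + (0, 1)).2.val ↔ ¬ ¬ Even r.2.val := not_congr (hsnd r)
  have hcard : (Fintype.card (Torus N) : ℝ) = (N : ℝ) ^ 2 := by
    rw [Fintype.card_prod, ZMod.card]
    push_cast
    ring
  constructor
  · rcases le_total J₁ J₂ with h | h
    · refine ⟨fun _ => (0, 1), fun _ => by norm_num, ?_⟩
      have h₁ := two_mul_sum_ite_one (1, 0) (fun r : Torus N => ¬ Even r.1.val) hfst'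
      have h₂ := two_mul_sum_ite_one (0, 1) (fun r : Torus N => ¬ Even r.2.val) hsnd'
      rw [hcard] at h₁ h₂
      simp only [ham, mul_zero, mul_one, ite_self, Finset.sum_const_zero, add_zero, max_eq_right h]
      linear_combination (-J₂ / 2) * h₁ + (-J₂ / 2) * h₂
    · refine ⟨fun _ => (1, 0), fun _ => by norm_num, ?_⟩
      have h₁ := two_mul_sum_ite_one (1, 0) (fun r : Torus N => Even r.1.val) hfst
      have h₂ := two_mul_sum_ite_one (0, 1) (fun r : Torus N => Even r.2.val) hsnd
      rw [hcard] at h₁ h₂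
      simp only [ham, mul_zero, mul_one, ite_self, Finset.sum_const_zero, add_zero, max_eq_left h]
      linear_combination (-J₁ / 2) * h₁ + (-J₁ / 2) * h₂
  · rintro E ⟨S, hS, rfl⟩
    have hx₁ := two_mul_sum_ite_mul_translate_le (1, 0) (fun r : Torus N => Even r.1.val) hfst
      (fun r => (S r).1)
    have hx₂ := two_mul_sum_ite_mul_translate_le (0, 1) (fun r : Torus N => Even r.2.val) hsnd
      (fun r => (S r).1)
    have hz₁ := two_mul_sum_ite_mul_translate_le (1, 0) (fun r : Torus N => ¬ Even r.1.val) hfst'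
      (fun r => (S r).2)
    have hz₂ := two_mul_sum_ite_mul_translate_le (0, 1) (fun r : Torus N => ¬ Even r.2.val) hsnd'
      (fun r => (S r).2)
    have htotal : (∑ r, (S r).1 ^ 2) + ∑ r, (S r).2 ^ 2 = (N : ℝ) ^ 2 := by
      rw [← Finset.sum_add_distrib, Finset.sum_congr rfl fun r _ => hS r, ← hcard]
      simp
    have hX : 0 ≤ ∑ r, (S r).1 ^ 2 := Finset.sum_nonneg fun _ _ => sq_nonneg _
    have hZ : 0 ≤ ∑ r, (S r).2 ^ 2 := Finset.sum_nonneg fun _ _ => sq_nonneg _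
    have hJX := mul_le_mul_of_nonneg_right (le_max_left J₁ J₂) hX
    have hJZ := mul_le_mul_of_nonneg_right (le_max_right J₁ J₂) hZ
    have h₁ := mul_le_mul_of_nonneg_left (add_le_add hx₁ hx₂) hJ₁.le
    have h₂ := mul_le_mul_of_nonneg_left (add_le_add hz₁ hz₂) hJ₂.le
    rw [← htotal]
    unfold ham
    linarith
end

section
/- Fix βJ > 0 and define F via the integral below. Then: (i) F(θ) is finite for every θ with sin(2θ) ≠ 0; (ii) F(θ + π/2) = F(θ) for all θ (period π/2); (iii) F(π/2 − θ) = F(θ) for all θ ∈ (0, π/2) (symmetry about π/4); (iv) F is increasing on (0, π/4) and decreasing on (π/4, π/2); and (v) F(θ) → −∞ as θ → 0⁺, so the infimum of F is −∞ and it is approached exactly at the multiples of π/2. -/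
open MeasureTheory

/-- `a₋ = 1 − e^{−ik}`. -/
noncomputable def am (k : ℝ) : ℂ := 1 - Complex.exp (-Complex.I * k)

/-- `a₊ = 1 + e^{−ik}`. -/
noncomputable def ap (k : ℝ) : ℂ := 1 + Complex.exp (-Complex.I * k)

/-- The 4×4 matrix `M(k,θ)` of the spin-wave quadratic form, with `ρ = −cos(2θ)`. -/
noncomputable def Mmat (k₁ k₂ θ : ℝ) : Matrix (Fin 4) (Fin 4) ℂ :=
  let ρ : ℂ := ((-Real.cos (2 * θ) : ℝ) : ℂ)
  let aMv := am k₁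
  let aPv := ap k₁
  let bMv := am k₂
  let bPv := ap k₂
  (1 / 2 : ℂ) •
    !![((Complex.normSq aMv + Complex.normSq bMv : ℝ) : ℂ), ρ * aMv * (starRingEnd ℂ) aPv,
         ρ * bMv * (starRingEnd ℂ) bPv, 0;
       ρ * (starRingEnd ℂ) aMv * aPv, ((Complex.normSq aPv + Complex.normSq bMv : ℝ) : ℂ), 0,
         ρ * bMv * (starRingEnd ℂ) bPv;
       ρ * (starRingEnd ℂ) bMv * bPv, 0, ((Complex.normSq aMv + Complex.normSq bPv : ℝ) : ℂ),
         ρ * aMv * (starRingEnd ℂ) aPv;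
       0, ρ * (starRingEnd ℂ) bMv * bPv, ρ * (starRingEnd ℂ) aMv * aPv,
         ((Complex.normSq aPv + Complex.normSq bPv : ℝ) : ℂ)]

/-- The square `[−π,π]²` of momenta. -/
noncomputable def momentumSquare : Set (ℝ × ℝ) :=
  Set.Icc (-Real.pi) Real.pi ×ˢ Set.Icc (-Real.pi) Real.pi

/-- The spin-wave free energy
`F(θ) = ½ log(βJ) + (1/8) ∫_{[−π,π]²} log det M(k,θ) dk/(2π)²`
(the determinant being real). -/
noncomputable def Fsw (βJ θ : ℝ) : ℝ :=
  (1 / 2) * Real.log βJ +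
    (1 / 8) * (∫ k in momentumSquare, Real.log ((Mmat k.1 k.2 θ).det).re) /
      (2 * Real.pi) ^ 2

lemma exp_neg_I_mul_ofReal (k : ℝ) :
    Complex.exp (-Complex.I * k) = (Real.cos k : ℂ) - Real.sin k * Complex.I := by
  rw [show -Complex.I * k = (-k : ℂ) * Complex.I by ring, Complex.exp_mul_I]
  simp [sub_eq_add_neg]

lemma normSq_am (k : ℝ) : Complex.normSq (am k) = 2 - 2 * Real.cos k := by
  rw [am, exp_neg_I_mul_ofReal, Complex.normSq_apply]
  simp [Complex.cos_ofReal_re, Complex.sin_ofReal_re]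
  nlinarith [Real.sin_sq_add_cos_sq k]

lemma normSq_ap (k : ℝ) : Complex.normSq (ap k) = 2 + 2 * Real.cos k := by
  rw [ap, exp_neg_I_mul_ofReal, Complex.normSq_apply]
  simp [Complex.cos_ofReal_re, Complex.sin_ofReal_re]
  nlinarith [Real.sin_sq_add_cos_sq k]

lemma am_mul_conj_ap (k : ℝ) :
    am k * (starRingEnd ℂ) (ap k) = 2 * (Real.sin k * Complex.I) := by
  rw [am, ap, exp_neg_I_mul_ofReal]
  have := Real.sin_sq_add_cos_sq k
  apply Complex.ext <;> simp [Complex.cos_ofReal_re, Complex.sin_ofReal_re] <;> nlinarith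

lemma conj_am_mul_ap (k : ℝ) :
    (starRingEnd ℂ) (am k) * ap k = -(2 * (Real.sin k * Complex.I)) := by
  have := congrArg (starRingEnd ℂ) (am_mul_conj_ap k)
  simpa [Complex.conj_ofReal, -Complex.ofReal_sin, Complex.conj_ofNat] using this

lemma det_fourByFour {R : Type*} [CommRing R] (c d u v : R) :
    Matrix.det !![2 - c - d, u, v, 0; -u, 2 + c - d, 0, v; -v, 0, 2 - c + d, u;
        0, -v, -u, 2 + c + d] =
      16 - 8 * ((c ^ 2 - u ^ 2) + (d ^ 2 - v ^ 2)) + ((c ^ 2 - u ^ 2) - (d ^ 2 - v ^ 2)) ^ 2 := by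
  simp [Matrix.det_succ_row_zero, Fin.sum_univ_succ, Fin.succAbove]
  ring

lemma Mmat_eq (k₁ k₂ θ : ℝ) :
    Mmat k₁ k₂ θ =
      let c : ℂ := Real.cos k₁
      let d : ℂ := Real.cos k₂
      let u : ℂ := -Real.cos (2 * θ) * (Real.sin k₁ * Complex.I)
      let v : ℂ := -Real.cos (2 * θ) * (Real.sin k₂ * Complex.I)
      !![2 - c - d, u, v, 0; -u, 2 + c - d, 0, v; -v, 0, 2 - c + d, u;
        0, -v, -u, 2 + c + d] := by
  simp only [Mmat, normSq_am, normSq_ap, mul_assoc, am_mul_conj_ap, conj_am_mul_ap]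
  ext i j
  fin_cases i <;> fin_cases j <;>
    simp [-Complex.ofReal_cos, -Complex.ofReal_sin] <;> ring

/-- The determinant of `M(k,θ)` in terms of `t = sin²(2θ)`, `x = sin² k₁` and `y = sin² k₂`. -/
noncomputable def detPoly (t : ℝ) (k : ℝ × ℝ) : ℝ :=
  t * (8 * (Real.sin k.1 ^ 2 + Real.sin k.2 ^ 2) +
    t * (Real.sin k.1 ^ 2 - Real.sin k.2 ^ 2) ^ 2)

lemma det_Mmat_re (k₁ k₂ θ : ℝ) :
    ((Mmat k₁ k₂ θ).det).re = detPoly (Real.sin (2 * θ) ^ 2) (k₁, k₂) := by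
  have key : (Mmat k₁ k₂ θ).det = ((detPoly (Real.sin (2 * θ) ^ 2) (k₁, k₂) : ℝ) : ℂ) := by
    have sq (k : ℝ) : (Real.cos k : ℂ) ^ 2 -
        (-Real.cos (2 * θ) * (Real.sin k * Complex.I)) ^ 2 =
        ((1 - Real.sin (2 * θ) ^ 2 * Real.sin k ^ 2 : ℝ) : ℂ) := by
      have h : Real.cos k ^ 2 + Real.cos (2 * θ) ^ 2 * Real.sin k ^ 2 =
          1 - Real.sin (2 * θ) ^ 2 * Real.sin k ^ 2 := by
        rw [Real.cos_sq' k, Real.cos_sq' (2 * θ)]; ring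
      rw [← h]
      push_cast
      linear_combination (-Complex.cos (2 * θ) ^ 2 * Complex.sin k ^ 2) * Complex.I_sq
    simp only [Mmat_eq, det_fourByFour, sq, detPoly]
    push_cast
    ring
  rw [key, Complex.ofReal_re]

lemma Fsw_eq (βJ θ : ℝ) :
    Fsw βJ θ = (1 / 2) * Real.log βJ +
      (1 / 8) * (∫ k in momentumSquare, Real.log (detPoly (Real.sin (2 * θ) ^ 2) k)) /
        (2 * Real.pi) ^ 2 := by
  simp only [Fsw, det_Mmat_re]

lemma volume_momentumSquare :
    volume momentumSquare = ENNReal.ofReal ((2 * Real.pi) ^ 2) := by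
  rw [momentumSquare, Measure.volume_eq_prod, Measure.prod_prod, Real.volume_Icc,
    ← ENNReal.ofReal_mul (by linarith [Real.pi_pos])]
  congr 1; ring

lemma volume_real_momentumSquare : volume.real momentumSquare = (2 * Real.pi) ^ 2 := by
  rw [Measure.real, volume_momentumSquare, ENNReal.toReal_ofReal (by positivity)]

lemma volume_restrict_momentumSquare :
    volume.restrict momentumSquare =
      (volume.restrict (Set.Icc (-Real.pi) Real.pi)).prod
        (volume.restrict (Set.Icc (-Real.pi) Real.pi)) := by
  rw [Measure.prod_restrict, ← Measure.volume_eq_prod, momentumSquare]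

lemma integrableOn_log_sin_fst :
    IntegrableOn (fun k : ℝ × ℝ => Real.log (Real.sin k.1)) momentumSquare := by
  have h : IntegrableOn (fun x : ℝ => Real.log (Real.sin x)) (Set.Icc (-Real.pi) Real.pi) := by
    rw [integrableOn_Icc_iff_integrableOn_Ioc,
      ← intervalIntegrable_iff_integrableOn_Ioc_of_le (by linarith [Real.pi_pos])]
    exact intervalIntegrable_log_sin
  rw [IntegrableOn, volume_restrict_momentumSquare]
  exact h.comp_fst _

lemma ae_sin_fst_ne_zero : ∀ᵐ k : ℝ × ℝ, Real.sin k.1 ≠ 0 := by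
  have h : ∀ᵐ x : ℝ, Real.sin x ≠ 0 := by
    have hc : {x : ℝ | Real.sin x = 0}.Countable := by
      refine (Set.countable_range fun n : ℤ => (n : ℝ) * Real.pi).mono fun x hx => ?_
      exact Real.sin_eq_zero_iff.1 hx
    simpa [ae_iff] using hc.measure_zero volume
  rw [Measure.volume_eq_prod]
  exact Measure.quasiMeasurePreserving_fst.ae h

lemma mul_sin_sq_le_detPoly {t : ℝ} (ht : 0 ≤ t) (k : ℝ × ℝ) :
    8 * t * Real.sin k.1 ^ 2 ≤ detPoly t k := by
  have : 0 ≤ t * (8 * Real.sin k.2 ^ 2 + t * (Real.sin k.1 ^ 2 - Real.sin k.2 ^ 2) ^ 2) := by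
    positivity
  rw [detPoly]; linarith

lemma detPoly_le {t : ℝ} (ht : 0 ≤ t) (k : ℝ × ℝ) : detPoly t k ≤ t * (16 + t) := by
  have hx := Real.sin_sq_le_one k.1
  have hy := Real.sin_sq_le_one k.2
  have hx' := sq_nonneg (Real.sin k.1)
  have hy' := sq_nonneg (Real.sin k.2)
  have : (Real.sin k.1 ^ 2 - Real.sin k.2 ^ 2) ^ 2 ≤ 1 := by
    rw [sq_le_one_iff_abs_le_one, abs_le]; constructor <;> linarith
  have := mul_le_mul_of_nonneg_left this ht
  rw [detPoly]
  exact mul_le_mul_of_nonneg_left (by linarith) ht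

lemma integrableOn_log_detPoly {t : ℝ} (ht : 0 < t) :
    IntegrableOn (fun k => Real.log (detPoly t k)) momentumSquare := by
  have hfin : volume momentumSquare ≠ ⊤ := by simp [volume_momentumSquare]
  have hlow : IntegrableOn
      (fun k : ℝ × ℝ => Real.log (8 * t) + 2 * Real.log (Real.sin k.1)) momentumSquare :=
    (integrableOn_const hfin).add (integrableOn_log_sin_fst.const_mul 2)
  refine integrable_of_le_of_le (μ := volume.restrict momentumSquare) ?_ ?_ ?_ hlow
    (integrableOn_const (C := Real.log (t * (16 + t))) hfin)
  · refine (Real.measurable_log.comp ?_).aestronglyMeasurable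
    unfold detPoly
    fun_prop
  · filter_upwards [ae_restrict_of_ae ae_sin_fst_ne_zero] with k hk
    have hpos : 0 < Real.sin k.1 ^ 2 := by positivity
    calc Real.log (8 * t) + 2 * Real.log (Real.sin k.1)
        = Real.log (8 * t * Real.sin k.1 ^ 2) := by
          rw [Real.log_mul (by positivity) hpos.ne', Real.log_pow]; simp
      _ ≤ _ := Real.log_le_log (by positivity) (mul_sin_sq_le_detPoly ht.le k)
  · filter_upwards [ae_restrict_of_ae ae_sin_fst_ne_zero] with k hk
    have hpos : 0 < Real.sin k.1 ^ 2 := by positivity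
    exact Real.log_le_log (lt_of_lt_of_le (by positivity) (mul_sin_sq_le_detPoly ht.le k))
      (detPoly_le ht.le k)

lemma log_detPoly_add_le {s t : ℝ} (hs : 0 < s) (hst : s ≤ t) {k : ℝ × ℝ}
    (hk : Real.sin k.1 ≠ 0) :
    Real.log (detPoly s k) + (Real.log t - Real.log s) ≤ Real.log (detPoly t k) := by
  have ht : 0 < t := hs.trans_le hst
  have hpos : 0 < Real.sin k.1 ^ 2 := by positivity
  have hq {r : ℝ} (hr : 0 < r) : 0 < 8 * (Real.sin k.1 ^ 2 + Real.sin k.2 ^ 2) +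
      r * (Real.sin k.1 ^ 2 - Real.sin k.2 ^ 2) ^ 2 := by positivity
  rw [detPoly, detPoly, Real.log_mul hs.ne' (hq hs).ne', Real.log_mul ht.ne' (hq ht).ne']
  have := Real.log_le_log (hq hs) (add_le_add_right
    (mul_le_mul_of_nonneg_right hst (sq_nonneg (Real.sin k.1 ^ 2 - Real.sin k.2 ^ 2)))
    (8 * (Real.sin k.1 ^ 2 + Real.sin k.2 ^ 2)))
  linarith

/-- Quantitative growth of `F` as a function of `sin²(2θ)`. -/
lemma Fsw_add_log_le (βJ : ℝ) {θ φ : ℝ} (hθ : Real.sin (2 * θ) ≠ 0)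
    (h : Real.sin (2 * θ) ^ 2 ≤ Real.sin (2 * φ) ^ 2) :
    Fsw βJ θ + (1 / 8) * (Real.log (Real.sin (2 * φ) ^ 2) - Real.log (Real.sin (2 * θ) ^ 2)) ≤
      Fsw βJ φ := by
  rw [Fsw_eq, Fsw_eq]
  set s := Real.sin (2 * θ) ^ 2 with hs_def
  set t := Real.sin (2 * φ) ^ 2
  have hs : 0 < s := by positivity
  have hfin : volume momentumSquare ≠ ⊤ := by simp [volume_momentumSquare]
  have hc : IntegrableOn (fun _ : ℝ × ℝ => Real.log t - Real.log s) momentumSquare :=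
    integrableOn_const hfin
  have hmono := integral_mono_ae ((integrableOn_log_detPoly hs).add hc)
    (integrableOn_log_detPoly (hs.trans_le h))
    (by
      filter_upwards [ae_restrict_of_ae ae_sin_fst_ne_zero] with k hk
      exact log_detPoly_add_le hs h hk)
  simp only [Pi.add_apply] at hmono
  rw [integral_add (integrableOn_log_detPoly hs) hc, setIntegral_const,
    volume_real_momentumSquare, smul_eq_mul] at hmono
  have hV : 0 < (2 * Real.pi) ^ 2 := by positivity
  have := div_le_div_of_nonneg_right hmono hV.le
  rw [add_div, mul_div_cancel_left₀ _ hV.ne'] at this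
  rw [mul_div_assoc, mul_div_assoc]
  linarith

lemma strictMonoOn_Fsw (βJ : ℝ) : StrictMonoOn (Fsw βJ) (Set.Ioo 0 (Real.pi / 4)) := by
  rintro θ ⟨hθ₀, hθ₁⟩ φ ⟨hφ₀, hφ₁⟩ hlt
  have hpos : 0 < Real.sin (2 * θ) := Real.sin_pos_of_pos_of_lt_pi (by linarith) (by linarith)
  have hsin : Real.sin (2 * θ) < Real.sin (2 * φ) :=
    Real.sin_lt_sin_of_lt_of_le_pi_div_two (by linarith) (by linarith) (by linarith)
  have hsq : Real.sin (2 * θ) ^ 2 < Real.sin (2 * φ) ^ 2 :=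
    pow_lt_pow_left₀ hsin hpos.le two_ne_zero
  have hlog := Real.log_lt_log (by positivity) hsq
  linarith [Fsw_add_log_le βJ hpos.ne' hsq.le]

lemma Fsw_congr (βJ : ℝ) {θ φ : ℝ} (h : Real.sin (2 * θ) ^ 2 = Real.sin (2 * φ) ^ 2) :
    Fsw βJ θ = Fsw βJ φ := by
  rw [Fsw_eq, Fsw_eq, h]

lemma Fsw_add_pi_div_two (βJ θ : ℝ) : Fsw βJ (θ + Real.pi / 2) = Fsw βJ θ := by
  apply Fsw_congr
  rw [show 2 * (θ + Real.pi / 2) = 2 * θ + Real.pi by ring, Real.sin_add_pi, neg_sq]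

lemma Fsw_pi_div_two_sub (βJ θ : ℝ) : Fsw βJ (Real.pi / 2 - θ) = Fsw βJ θ := by
  apply Fsw_congr
  rw [show 2 * (Real.pi / 2 - θ) = Real.pi - 2 * θ by ring, Real.sin_pi_sub]

lemma tendsto_Fsw_atBot (βJ : ℝ) :
    Filter.Tendsto (Fsw βJ) (nhdsWithin 0 (Set.Ioi 0)) Filter.atBot := by
  have hmem : Set.Ioo 0 (Real.pi / 4) ∈ nhdsWithin (0 : ℝ) (Set.Ioi 0) :=
    Ioo_mem_nhdsGT (by positivity)
  have hne : ∀ θ ∈ Set.Ioo 0 (Real.pi / 4), Real.sin (2 * θ) ≠ 0 := fun θ hθ =>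
    (Real.sin_pos_of_pos_of_lt_pi (by linarith [hθ.1]) (by linarith [hθ.1, hθ.2])).ne'
  have hsin : Filter.Tendsto (fun θ : ℝ => Real.sin (2 * θ) ^ 2)
      (nhdsWithin 0 (Set.Ioi 0)) (nhdsWithin 0 {0}ᶜ) := by
    refine tendsto_nhdsWithin_iff.2 ⟨?_, ?_⟩
    · have hcont : Continuous fun θ : ℝ => Real.sin (2 * θ) ^ 2 := by fun_prop
      simpa using (hcont.tendsto 0).mono_left nhdsWithin_le_nhds
    · filter_upwards [hmem] with θ hθ
      exact pow_ne_zero 2 (hne θ hθ)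
  have hlog := Filter.tendsto_atBot_add_const_left _ (Fsw βJ (Real.pi / 4))
    ((Real.tendsto_log_nhdsNE_zero.comp hsin).const_mul_atBot
      (show (0 : ℝ) < 1 / 8 by norm_num))
  refine Filter.tendsto_atBot_mono' _ ?_ hlog
  filter_upwards [hmem] with θ hθ
  have hone : Real.sin (2 * (Real.pi / 4)) = 1 := by
    rw [show 2 * (Real.pi / 4) = Real.pi / 2 by ring, Real.sin_pi_div_two]
  have := Fsw_add_log_le βJ (hne θ hθ) (φ := Real.pi / 4)
    (by rw [hone, one_pow]; exact Real.sin_sq_le_one _)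
  rw [hone, one_pow, Real.log_one] at this
  simp only [Function.comp_apply]
  linarith

/-- Properties of the spin-wave free energy `F`: finiteness (integrability) away
from the zeros of `sin(2θ)`, periodicity with period `π/2`, symmetry about `π/4`,
monotonicity on `(0,π/4)` and `(π/4,π/2)`, and divergence `F(θ) → −∞` as `θ → 0⁺`,
so that the infimum of `F` is `−∞` (approached exactly at the multiples of `π/2`). -/
theorem Fsw_properties (βJ : ℝ) (h : 0 < βJ) :
    (∀ θ : ℝ, Real.sin (2 * θ) ≠ 0 →
      IntegrableOn (fun k : ℝ × ℝ => Real.log ((Mmat k.1 k.2 θ).det).re)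
        momentumSquare) ∧
    (∀ θ : ℝ, Fsw βJ (θ + Real.pi / 2) = Fsw βJ θ) ∧
    (∀ θ ∈ Set.Ioo (0 : ℝ) (Real.pi / 2), Fsw βJ (Real.pi / 2 - θ) = Fsw βJ θ) ∧
    StrictMonoOn (Fsw βJ) (Set.Ioo 0 (Real.pi / 4)) ∧
    StrictAntiOn (Fsw βJ) (Set.Ioo (Real.pi / 4) (Real.pi / 2)) ∧
    Filter.Tendsto (Fsw βJ) (nhdsWithin 0 (Set.Ioi 0)) Filter.atBot ∧
    ¬ BddBelow (Set.range (Fsw βJ)) := by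
  refine ⟨fun θ hθ => ?_, Fsw_add_pi_div_two βJ, fun θ _ => Fsw_pi_div_two_sub βJ θ,
    strictMonoOn_Fsw βJ, ?_, tendsto_Fsw_atBot βJ, ?_⟩
  · simp only [det_Mmat_re]
    exact integrableOn_log_detPoly (by positivity)
  · rintro θ ⟨hθ₀, hθ₁⟩ φ ⟨hφ₀, hφ₁⟩ hlt
    rw [← Fsw_pi_div_two_sub βJ θ, ← Fsw_pi_div_two_sub βJ φ]
    exact strictMonoOn_Fsw βJ ⟨by linarith, by linarith⟩ ⟨by linarith, by linarith⟩ (by linarith)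
  · rintro ⟨b, hb⟩
    obtain ⟨θ, hθ⟩ := ((tendsto_Fsw_atBot βJ).eventually (Filter.eventually_lt_atBot b)).exists
    exact absurd (hb ⟨θ, rfl⟩) (not_le.2 hθ)
end
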